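/- Let E and F be finite-dimensional real normed spaces and Φ : E → F a Lipschitz map. Then for every p ∈ E the Clarke generalized differential ∂Φ(p) := convexHull ℝ (K_Φ(p)) is a nonempty, compact, convex subset of the space of continuous linear maps E → F with the operator norm. -/

import Mathlib

open Filter Topology

/-- The mixture of the differential of a Lipschitz map `Φ` at `p`: all operator-norm limits
of `fderiv ℝ Φ xᵢ` along sequences of differentiability points `xᵢ → p`. -/
def mixture {E F : Type*} [NormedAddCommGroup E] [NormedSpace ℝ E]
    [NormedAddCommGroup F] [NormedSpace ℝ F] (Φ : E → F) (p : E) :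
    Set (E →L[ℝ] F) :=
  {G : E →L[ℝ] F | ∃ x : ℕ → E, (∀ i, DifferentiableAt ℝ Φ (x i)) ∧
    Tendsto x atTop (𝓝 p) ∧ Tendsto (fun i => fderiv ℝ Φ (x i)) atTop (𝓝 G)}

/-- The Clarke generalized differential of `Φ` at `p`. -/
def clarke {E F : Type*} [NormedAddCommGroup E] [NormedSpace ℝ E]
    [NormedAddCommGroup F] [NormedSpace ℝ F] (Φ : E → F) (p : E) :
    Set (E →L[ℝ] F) :=
  convexHull ℝ (mixture Φ p)

/-- In a finite-dimensional real normed space, the convex hull of a compact set is compact. -/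
theorem IsCompact.convexHull_of_finiteDimensional {V : Type*} [NormedAddCommGroup V]
    [NormedSpace ℝ V] [FiniteDimensional ℝ V] {s : Set V} (hs : IsCompact s) :
    IsCompact (convexHull ℝ s) := by
  let f (k : ℕ) (q : (Fin k → ℝ) × (Fin k → V)) : V := ∑ i, q.1 i • q.2 i
  have key : convexHull ℝ s = ⋃ k ∈ Finset.range (Module.finrank ℝ V + 2),
      f k '' (stdSimplex ℝ (Fin k) ×ˢ Set.univ.pi fun _ => s) := by
    apply Set.Subset.antisymm
    · intro x hx
      obtain ⟨ι, _, z, w, hz, hind, hw, hw1, hx⟩ := eq_pos_convex_span_of_mem_convexHull hx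
      have hcard : Fintype.card ι < Module.finrank ℝ V + 2 := by
        have h1 := hind.card_le_finrank_succ
        have h2 := Submodule.finrank_le (vectorSpan ℝ (Set.range z))
        omega
      let e := (Fintype.equivFin ι).symm
      refine Set.mem_biUnion (Finset.mem_coe.2 (Finset.mem_range.2 hcard))
        ⟨(w ∘ e, z ∘ e), ⟨⟨fun i => (hw _).le, ?_⟩, fun i _ => hz ⟨_, rfl⟩⟩, ?_⟩
      · exact (e.sum_comp w).trans hw1
      · exact (e.sum_comp fun i => w i • z i).trans hx
    · refine Set.iUnion₂_subset fun k _ => ?_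
      rintro _ ⟨⟨w, z⟩, ⟨hw, hz⟩, rfl⟩
      exact (convex_convexHull ℝ s).sum_mem (fun i _ => hw.1 i) hw.2
        fun i _ => subset_convexHull ℝ s (hz i trivial)
  rw [key]
  refine Finset.isCompact_biUnion _ fun k _ => ?_
  exact ((isCompact_stdSimplex ℝ (Fin k)).prod (isCompact_univ_pi fun _ => hs)).image
    (by fun_prop)

section Mixture

variable {E F : Type*} [NormedAddCommGroup E] [NormedSpace ℝ E]
  [NormedAddCommGroup F] [NormedSpace ℝ F]

theorem mem_mixture_iff_mem_closure {Φ : E → F} {p : E} {G : E →L[ℝ] F} :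
    G ∈ mixture Φ p ↔
      (p, G) ∈ closure ((fun x => (x, fderiv ℝ Φ x)) '' {x | DifferentiableAt ℝ Φ x}) := by
  rw [mem_closure_iff_seq_limit]
  constructor
  · rintro ⟨x, hx, hxp, hxG⟩
    exact ⟨_, fun i => ⟨x i, hx i, rfl⟩, hxp.prodMk_nhds hxG⟩
  · rintro ⟨u, hu, hlim⟩
    choose x hx hxu using hu
    obtain rfl : (fun i => (x i, fderiv ℝ Φ (x i))) = u := funext hxu
    exact ⟨x, hx, (continuous_fst.tendsto _).comp hlim, (continuous_snd.tendsto _).comp hlim⟩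

theorem isClosed_mixture (Φ : E → F) (p : E) : IsClosed (mixture Φ p) := by
  have h : mixture Φ p = (fun G => (p, G)) ⁻¹'
      closure ((fun x => (x, fderiv ℝ Φ x)) '' {x | DifferentiableAt ℝ Φ x}) :=
    Set.ext fun _ => mem_mixture_iff_mem_closure
  rw [h]
  exact isClosed_closure.preimage (by fun_prop)

theorem mixture_subset_closedBall {Φ : E → F} {L : NNReal} (hΦ : LipschitzWith L Φ) (p : E) :
    mixture Φ p ⊆ Metric.closedBall 0 L := by
  rintro G ⟨x, -, -, hxG⟩
  exact Metric.isClosed_closedBall.mem_of_tendsto hxG <| .of_forall fun i =>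
    mem_closedBall_zero_iff.2 (norm_fderiv_le_of_lipschitz ℝ hΦ)

variable [FiniteDimensional ℝ E] [FiniteDimensional ℝ F]

theorem LipschitzWith.isCompact_mixture {Φ : E → F} {L : NNReal} (hΦ : LipschitzWith L Φ)
    (p : E) : IsCompact (mixture Φ p) :=
  have := FiniteDimensional.proper ℝ (E →L[ℝ] F)
  (isCompact_closedBall 0 (L : ℝ)).of_isClosed_subset (isClosed_mixture Φ p)
    (mixture_subset_closedBall hΦ p)

theorem LipschitzWith.dense_differentiableAt {Φ : E → F} {L : NNReal}
    (hΦ : LipschitzWith L Φ) : Dense {x | DifferentiableAt ℝ Φ x} := by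
  borelize E
  exact MeasureTheory.Measure.dense_of_ae
    (hΦ.ae_differentiableAt (μ := (Module.finBasis ℝ E).addHaar))

theorem LipschitzWith.mixture_nonempty {Φ : E → F} {L : NNReal} (hΦ : LipschitzWith L Φ)
    (p : E) : (mixture Φ p).Nonempty := by
  have := FiniteDimensional.proper ℝ (E →L[ℝ] F)
  obtain ⟨x, hx, hxp⟩ := mem_closure_iff_seq_limit.1 (hΦ.dense_differentiableAt p)
  obtain ⟨G, -, φ, hφ, hG⟩ := (isCompact_closedBall (0 : E →L[ℝ] F) (L : ℝ)).tendsto_subseq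
    (x := fun i => fderiv ℝ Φ (x i))
    fun i => mem_closedBall_zero_iff.2 (norm_fderiv_le_of_lipschitz ℝ hΦ)
  exact ⟨G, x ∘ φ, fun i => hx _, hxp.comp hφ.tendsto_atTop, hG⟩

end Mixture

theorem stmt_3 {E F : Type*}
    [NormedAddCommGroup E] [NormedSpace ℝ E] [FiniteDimensional ℝ E]
    [NormedAddCommGroup F] [NormedSpace ℝ F] [FiniteDimensional ℝ F]
    (Φ : E → F) (L : NNReal) (hΦ : LipschitzWith L Φ) (p : E) :
    (clarke Φ p).Nonempty ∧ IsCompact (clarke Φ p) ∧ Convex ℝ (clarke Φ p) :=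
  ⟨(hΦ.mixture_nonempty p).convexHull,
    (hΦ.isCompact_mixture p).convexHull_of_finiteDimensional,
    convex_convexHull ℝ _⟩
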